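/- arXiv:1101.3640 — 4 statements merged into one kernel-verified Lean document; each statement's English description precedes it below -/
import Mathlib

section
/- At all (u,t) ∈ Ω × I, the unit normal of the evolving surface satisfies ∂_t n = −(v^β b^α_β + a^{αβ} ∂_β vⁿ) a_α (summation over repeated indices). -/
noncomputable section

open scoped Real BigOperators

/-- Vectors in ℝ³. -/
abbrev V3 := Fin 3 → ℝ

def dot3 (v w : V3) : ℝ := v 0 * w 0 + v 1 * w 1 + v 2 * w 2

def cross3 (v w : V3) : V3 :=
  ![v 1 * w 2 - v 2 * w 1, v 2 * w 0 - v 0 * w 2, v 0 * w 1 - v 1 * w 0]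

def norm3 (v : V3) : ℝ := Real.sqrt (dot3 v v)

/-- A space-time point `(u, t) ∈ ℝ² × ℝ`. -/
abbrev Pt := (ℝ × ℝ) × ℝ

/-- Spatial coordinate directions. -/
def sdir : Fin 2 → Pt := ![((1,0),0), ((0,1),0)]

/-- Spatial partial derivative `∂_α` of a scalar function on space-time. -/
def pdS (α : Fin 2) (f : Pt → ℝ) : Pt → ℝ := fun p => fderiv ℝ f p (sdir α)

/-- Time derivative `∂_t` of a scalar function on space-time. -/
def pdT (f : Pt → ℝ) : Pt → ℝ := fun p => fderiv ℝ f p ((0,0),1)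

variable (R : Pt → V3)

/-- Tangent vector `a_α = ∂_α R`. -/
def aV (α : Fin 2) : Pt → V3 := fun p i => pdS α (fun q => R q i) p

/-- Metric tensor `a_{αβ} = a_α · a_β`. -/
def met (α β : Fin 2) : Pt → ℝ := fun p => dot3 (aV R α p) (aV R β p)

/-- Inverse metric `(a^{αβ})`. -/
def metInv (p : Pt) : Matrix (Fin 2) (Fin 2) ℝ := (Matrix.of fun α β => met R α β p)⁻¹

/-- Unit normal `n = (a₁ × a₂)/|a₁ × a₂|`. -/
def nor : Pt → V3 := fun p i =>
  cross3 (aV R 0 p) (aV R 1 p) i / norm3 (cross3 (aV R 0 p) (aV R 1 p))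

/-- Second fundamental form `b_{αβ} = ∂_α∂_β R · n`. -/
def bform (α β : Fin 2) : Pt → ℝ := fun p =>
  dot3 (fun i => pdS α (fun q => pdS β (fun r => R r i) q) p) (nor R p)

/-- Mixed second fundamental form `b^α_β = a^{αγ} b_{γβ}`. -/
def bMix (α β : Fin 2) : Pt → ℝ := fun p => ∑ γ : Fin 2, metInv R p α γ * bform R γ β p

/-- Christoffel symbols `Γ^γ_{αβ} = ½ a^{γδ}(∂_α a_{βδ} + ∂_β a_{αδ} − ∂_δ a_{αβ})`. -/
def chris (γ α β : Fin 2) : Pt → ℝ := fun p =>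
  (1/2) * ∑ δ : Fin 2, metInv R p γ δ *
    (pdS α (met R β δ) p + pdS β (met R α δ) p - pdS δ (met R α β) p)

/-- Velocity `v = ∂_t R`. -/
def vel : Pt → V3 := fun p i => pdT (fun q => R q i) p

/-- Contravariant components `v^α = a^{αβ}(v·a_β)`. -/
def vUp (α : Fin 2) : Pt → ℝ := fun p => ∑ β : Fin 2, metInv R p α β * dot3 (vel R p) (aV R β p)

/-- Normal component `vⁿ = v·n`. -/
def vN : Pt → ℝ := fun p => dot3 (vel R p) (nor R p)

/-- Covariant components `v_α = a_{αβ} v^β`. -/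
def vLow (α : Fin 2) : Pt → ℝ := fun p => ∑ β : Fin 2, met R α β p * vUp R β p

/-- Covariant derivative `v_{α,β} = ∂_β v_α − Γ^γ_{αβ} v_γ`. -/
def vLowCov (α β : Fin 2) : Pt → ℝ := fun p =>
  pdS β (vLow R α) p - ∑ γ : Fin 2, chris R γ α β p * vLow R γ p

/-- Covariant derivative `v^γ_{,β} = ∂_β v^γ + Γ^γ_{δβ} v^δ`. -/
def vUpCov (γ β : Fin 2) : Pt → ℝ := fun p =>
  pdS β (vUp R γ) p + ∑ δ : Fin 2, chris R γ δ β p * vUp R δ p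

/-- Covariant second derivative `vⁿ_{,αβ} = ∂_β∂_α vⁿ − Γ^γ_{αβ} ∂_γ vⁿ`. -/
def vNCov2 (α β : Fin 2) : Pt → ℝ := fun p =>
  pdS β (pdS α (vN R)) p - ∑ γ : Fin 2, chris R γ α β p * pdS γ (vN R) p

/-- Covariant derivative of the second fundamental form
`b_{αβ,γ} = ∂_γ b_{αβ} − Γ^δ_{αγ} b_{δβ} − Γ^δ_{βγ} b_{αδ}`. -/
def bCov (α β γ : Fin 2) : Pt → ℝ := fun p =>
  pdS γ (bform R α β) p - (∑ δ : Fin 2, chris R δ α γ p * bform R δ β p)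
    - ∑ δ : Fin 2, chris R δ β γ p * bform R α δ p

/-- Mean curvature `H = ½ a^{αβ} b_{αβ}`. -/
def meanH : Pt → ℝ := fun p =>
  (1/2) * ∑ α : Fin 2, ∑ β : Fin 2, metInv R p α β * bform R α β p


theorem aux_two : (2 : WithTop ℕ∞) ≤ ((⊤ : ℕ∞) : WithTop ℕ∞) := by
  have : ((2 : ℕ∞) : WithTop ℕ∞) ≤ ((⊤ : ℕ∞) : WithTop ℕ∞) := WithTop.coe_le_coe.2 le_top
  exact this

theorem aux_two' : (1 + 1 : WithTop ℕ∞) ≤ ((⊤ : ℕ∞) : WithTop ℕ∞) := by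
  rw [one_add_one_eq_two]; exact aux_two

theorem aux_dot_fderiv (f g : Pt → V3) (p w : Pt)
    (hf : ∀ i, DifferentiableAt ℝ (fun q => f q i) p)
    (hg : ∀ i, DifferentiableAt ℝ (fun q => g q i) p) :
    fderiv ℝ (fun q => dot3 (f q) (g q)) p w =
      dot3 (fun i => fderiv ℝ (fun q => f q i) p w) (g p) +
      dot3 (f p) (fun i => fderiv ℝ (fun q => g q i) p w) := by
  have h := ((((hf 0).hasFDerivAt.mul (hg 0).hasFDerivAt).add
    ((hf 1).hasFDerivAt.mul (hg 1).hasFDerivAt)).add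
    ((hf 2).hasFDerivAt.mul (hg 2).hasFDerivAt))
  have h2 : HasFDerivAt (fun q => dot3 (f q) (g q)) _ p := h
  rw [h2.fderiv]
  simp [dot3]
  ring

theorem aux_swap (f : Pt → ℝ) (p v w : Pt) (hf : ContDiffAt ℝ (⊤ : ℕ∞) f p) :
    fderiv ℝ (fun q => fderiv ℝ f q v) p w = fderiv ℝ (fun q => fderiv ℝ f q w) p v := by
  have hd : DifferentiableAt ℝ (fderiv ℝ f) p :=
    (hf.fderiv_right (m := 1) aux_two').differentiableAt (by simp)
  have hs : IsSymmSndFDerivAt ℝ f p :=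
    hf.isSymmSndFDerivAt (by simp only [minSmoothness_of_isRCLikeNormedField]; exact aux_two)
  have e : ∀ v w, fderiv ℝ (fun q => fderiv ℝ f q v) p w = fderiv ℝ (fderiv ℝ f) p w v := by
    intro v w
    rw [fderiv_clm_apply hd (differentiableAt_const v)]
    simp
  rw [e, e, hs.eq]

theorem aux_diff (f : Pt → ℝ) (p v : Pt) (hf : ContDiffAt ℝ (⊤ : ℕ∞) f p) :
    DifferentiableAt ℝ (fun q => fderiv ℝ f q v) p := by
  have hd : DifferentiableAt ℝ (fderiv ℝ f) p :=
    (hf.fderiv_right (m := 1) aux_two').differentiableAt (by simp)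
  exact hd.clm_apply (differentiableAt_const v)

theorem aux_cross_pos (a b : V3) (h : LinearIndependent ℝ ![a, b]) :
    0 < dot3 (cross3 a b) (cross3 a b) := by
  have h0 : 0 ≤ dot3 (cross3 a b) (cross3 a b) := by
    unfold dot3; nlinarith [sq_nonneg (cross3 a b 0), sq_nonneg (cross3 a b 1), sq_nonneg (cross3 a b 2)]
  rcases h0.lt_or_eq with h1 | h1
  · exact h1
  exfalso
  have hc : ∀ i, cross3 a b i = 0 := by
    unfold dot3 at h1
    intro i
    fin_cases i <;> simp only [Fin.zero_eta, Fin.mk_one, Fin.reduceFinMk] <;>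
      nlinarith [sq_nonneg (cross3 a b 0), sq_nonneg (cross3 a b 1), sq_nonneg (cross3 a b 2)]
  have c0 := hc 0
  have c1 := hc 1
  have c2 := hc 2
  simp [cross3] at c0 c1 c2
  rw [LinearIndependent.pair_iff] at h
  have hb : b = 0 := by
    funext j
    have : b j • a + (-(a j)) • b = 0 := by
      funext i
      fin_cases j <;> fin_cases i <;> simp <;> linarith
    exact (h _ _ this).1
  have := h 0 1 (by simp [hb])
  simp at this

theorem aux_metInv (p : Pt) (h : 0 < dot3 (cross3 (aV R 0 p) (aV R 1 p)) (cross3 (aV R 0 p) (aV R 1 p)))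
    (x : V3) (i : Fin 3) :
    x i = (∑ α : Fin 2, (∑ β : Fin 2, metInv R p α β * dot3 x (aV R β p)) * aV R α p i)
      + dot3 x (nor R p) * nor R p i := by
  set D := dot3 (cross3 (aV R 0 p) (aV R 1 p)) (cross3 (aV R 0 p) (aV R 1 p)) with hD
  have hdet : met R 0 0 p * met R 1 1 p - met R 0 1 p * met R 1 0 p = D := by
    rw [hD]; simp [met, dot3, cross3]; ring
  have hi : ∀ α β, metInv R p α β = D⁻¹ * (!![met R 1 1 p, -met R 0 1 p; -met R 1 0 p, met R 0 0 p] α β) := by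
    intro α β
    unfold metInv
    rw [Matrix.inv_def, Matrix.adjugate_fin_two, Matrix.det_fin_two]
    simp [hdet]
  have hn : dot3 x (nor R p) * nor R p i =
      D⁻¹ * (dot3 x (cross3 (aV R 0 p) (aV R 1 p)) * cross3 (aV R 0 p) (aV R 1 p) i) := by
    have hs : Real.sqrt D * Real.sqrt D = D := Real.mul_self_sqrt h.le
    have : D⁻¹ = (Real.sqrt D)⁻¹ * (Real.sqrt D)⁻¹ := by rw [← mul_inv, hs]
    rw [this]
    have hj : ∀ j, nor R p j = cross3 (aV R 0 p) (aV R 1 p) j * (Real.sqrt D)⁻¹ := fun j => by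
      rw [← div_eq_mul_inv]; rfl
    simp only [dot3, hj]
    ring
  rw [hn]
  simp only [hi, Fin.sum_univ_two]
  have : D ≠ 0 := h.ne'
  field_simp
  rw [hD]
  simp only [met]
  generalize aV R 0 p = a
  generalize aV R 1 p = b
  fin_cases i <;> simp [dot3, cross3] <;> ring

theorem aux_nor_aV (α : Fin 2) (p : Pt) : dot3 (nor R p) (aV R α p) = 0 := by
  fin_cases α <;> simp [dot3, nor, cross3] <;> ring

theorem aux_nor_nor (p : Pt) (h : 0 < dot3 (cross3 (aV R 0 p) (aV R 1 p)) (cross3 (aV R 0 p) (aV R 1 p))) :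
    dot3 (nor R p) (nor R p) = 1 := by
  have hs := Real.mul_self_sqrt h.le
  have h0 := (Real.sqrt_pos.2 h).ne'
  have hj : ∀ j, nor R p j = cross3 (aV R 0 p) (aV R 1 p) j / Real.sqrt (dot3 (cross3 (aV R 0 p) (aV R 1 p)) (cross3 (aV R 0 p) (aV R 1 p))) := fun j => rfl
  set c := cross3 (aV R 0 p) (aV R 1 p)
  have e : dot3 c c = c 0 * c 0 + c 1 * c 1 + c 2 * c 2 := rfl
  generalize Real.sqrt (dot3 c c) = s at *
  rw [e] at hs
  unfold dot3
  simp only [hj]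
  field_simp
  linarith

theorem aux_comm (v w : V3) : dot3 v w = dot3 w v := by unfold dot3; ring

/-- evolution of the unit normal, equation `eq:normal evolution`:
`∂_t n = −(v^β b^α_β + a^{αβ} ∂_β vⁿ) a_α` on `Ω × I`. -/
theorem statement13 (Ω : Set (ℝ × ℝ)) (I : Set ℝ)
    (hΩ : IsOpen Ω) (hIo : IsOpen I) (hIc : I.OrdConnected)
    (R : Pt → V3)
    (hR : ∀ i : Fin 3, ContDiffOn ℝ (⊤ : ℕ∞) (fun p => R p i) (Ω ×ˢ I))
    (hind : ∀ p ∈ Ω ×ˢ I, LinearIndependent ℝ ![aV R 0 p, aV R 1 p]) :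
    ∀ p ∈ Ω ×ˢ I, ∀ i : Fin 3,
      pdT (fun q => nor R q i) p =
        -∑ α : Fin 2,
          ((∑ β : Fin 2, vUp R β p * bMix R α β p) +
            ∑ β : Fin 2, metInv R p α β * pdS β (vN R) p) * aV R α p i := by
  have hU : IsOpen (Ω ×ˢ I) := hΩ.prod hIo
  intro p hp i
  have hRp : ∀ i, ContDiffAt ℝ (⊤ : ℕ∞) (fun q => R q i) p := fun i =>
    (hR i).contDiffAt (hU.mem_nhds hp)
  have hpos : ∀ q ∈ Ω ×ˢ I, 0 < dot3 (cross3 (aV R 0 q) (aV R 1 q)) (cross3 (aV R 0 q) (aV R 1 q)) :=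
    fun q hq => aux_cross_pos _ _ (hind q hq)
  have hda : ∀ α i, DifferentiableAt ℝ (fun q => aV R α q i) p := fun α i =>
    aux_diff _ p _ (hRp i)
  have hdv : ∀ i, DifferentiableAt ℝ (fun q => vel R q i) p := fun i =>
    aux_diff _ p _ (hRp i)
  have hdc : ∀ i, DifferentiableAt ℝ (fun q => cross3 (aV R 0 q) (aV R 1 q) i) p := by
    intro i
    fin_cases i
    · exact ((hda 0 1).mul (hda 1 2)).sub ((hda 0 2).mul (hda 1 1))
    · exact ((hda 0 2).mul (hda 1 0)).sub ((hda 0 0).mul (hda 1 2))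
    · exact ((hda 0 0).mul (hda 1 1)).sub ((hda 0 1).mul (hda 1 0))
  have hdn : ∀ i, DifferentiableAt ℝ (fun q => nor R q i) p := by
    intro i
    have hD : DifferentiableAt ℝ (fun q => dot3 (cross3 (aV R 0 q) (aV R 1 q))
        (cross3 (aV R 0 q) (aV R 1 q))) p :=
      (((hdc 0).mul (hdc 0)).add ((hdc 1).mul (hdc 1))).add ((hdc 2).mul (hdc 2))
    have hS := hD.sqrt (hpos p hp).ne'
    have hne : (fun y => Real.sqrt (dot3 (cross3 (aV R 0 y) (aV R 1 y))
        (cross3 (aV R 0 y) (aV R 1 y)))) p ≠ 0 := (Real.sqrt_pos.2 (hpos p hp)).ne'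
    have hQ := (hdc i).fun_mul (hS.fun_inv hne)
    simp only [← div_eq_mul_inv] at hQ
    exact hQ
  -- derivative of n in any direction is tangential
  have hnn : ∀ w, dot3 (fun i => fderiv ℝ (fun q => nor R q i) p w) (nor R p) = 0 := by
    intro w
    have h1 := aux_dot_fderiv (nor R) (nor R) p w hdn hdn
    have h2 : (fun q => dot3 (nor R q) (nor R q)) =ᶠ[nhds p] fun _ => (1 : ℝ) := by
      filter_upwards [hU.mem_nhds hp] with q hq
      exact aux_nor_nor R q (hpos q hq)
    rw [h2.fderiv_eq, aux_comm (nor R p)] at h1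
    simp at h1
    linarith
  have hna : ∀ α w, dot3 (fun i => fderiv ℝ (fun q => nor R q i) p w) (aV R α p) =
      - dot3 (fun i => fderiv ℝ (fun q => aV R α q i) p w) (nor R p) := by
    intro α w
    have h1 := aux_dot_fderiv (nor R) (aV R α) p w hdn (hda α)
    have h2 : (fun q => dot3 (nor R q) (aV R α q)) = fun _ => (0 : ℝ) := by
      funext q; exact aux_nor_aV R α q
    rw [h2, aux_comm (nor R p)] at h1
    simp at h1
    linarith
  have hb : ∀ α β, dot3 (fun i => fderiv ℝ (fun q => nor R q i) p (sdir β)) (aV R α p) =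
      - bform R β α p := fun α β => hna α (sdir β)
  have hvn : ∀ β, pdS β (vN R) p = dot3 (fun i => fderiv ℝ (fun q => vel R q i) p (sdir β)) (nor R p)
      - ∑ γ : Fin 2, vUp R γ p * bform R β γ p := by
    intro β
    have h1 := aux_dot_fderiv (vel R) (nor R) p (sdir β) hdv hdn
    have hn0 := hnn (sdir β)
    have hb0 := hb 0 β
    have hb1 := hb 1 β
    have hv := fun i => aux_metInv R p (hpos p hp) (vel R p) i
    have h3 : dot3 (vel R p) (fun i => fderiv ℝ (fun q => nor R q i) p (sdir β)) =
        - ∑ γ : Fin 2, vUp R γ p * bform R β γ p := by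
      change ∀ i, vel R p i = (∑ α : Fin 2, vUp R α p * aV R α p i) + _ at hv
      simp only [Fin.sum_univ_two] at hv ⊢
      generalize dot3 (vel R p) (nor R p) = m at hv
      generalize (fun i => fderiv ℝ (fun q => nor R q i) p (sdir β)) = x at *
      unfold dot3 at *
      rw [hv 0, hv 1, hv 2]
      linear_combination vUp R 0 p * hb0 + vUp R 1 p * hb1 + m * hn0
    rw [h3] at h1
    change fderiv ℝ (fun q => dot3 (vel R q) (nor R q)) p (sdir β) = _
    rw [h1]; ring
  have hta : ∀ β, dot3 (fun i => fderiv ℝ (fun q => nor R q i) p ((0,0),1)) (aV R β p) =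
      - (pdS β (vN R) p + ∑ γ : Fin 2, vUp R γ p * bform R β γ p) := by
    intro β
    rw [hna, hvn]
    have : ∀ i, fderiv ℝ (fun q => aV R β q i) p ((0,0),1) =
        fderiv ℝ (fun q => vel R q i) p (sdir β) := fun i => aux_swap _ p _ _ (hRp i)
    simp only [this]
    ring
  have key := aux_metInv R p (hpos p hp) (fun i => fderiv ℝ (fun q => nor R q i) p ((0,0),1)) i
  rw [hnn] at key
  simp only [hta] at key
  change fderiv ℝ (fun q => nor R q i) p ((0,0),1) = _
  rw [key]
  simp only [bMix, Fin.sum_univ_two]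
  ring
end
end

section
/- At all (u,t) ∈ Ω × I, the mean curvature of the evolving surface satisfies 2 ∂_t H = a^{αβ} vⁿ_{,αβ} + vⁿ b^α_β b^β_α + 2 v^α ∂_α H (summation over repeated indices). -/
noncomputable section

open scoped Real BigOperators

variable (R : Pt → V3)

section helpers

def Dd (e : Pt) (f : Pt → ℝ) : Pt → ℝ := fun p => fderiv ℝ f p e
def DV (e : Pt) (X : Pt → V3) : Pt → V3 := fun p i => Dd e (fun q => X q i) p
def SV (U : Set Pt) (X : Pt → V3) : Prop :=
  ∀ i : Fin 3, ContDiffOn ℝ (⊤ : ℕ∞) (fun p => X p i) U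

lemma smooth_Dd {U : Set Pt} (hU : IsOpen U) {f : Pt → ℝ} (hf : ContDiffOn ℝ (⊤ : ℕ∞) f U)
    (e : Pt) : ContDiffOn ℝ (⊤ : ℕ∞) (Dd e f) U := by
  have h : ContDiffOn ℝ (⊤ : ℕ∞) (fderiv ℝ f) U := hf.fderiv_of_isOpen hU (by simp)
  exact h.clm_apply contDiffOn_const

lemma smooth_DV {U : Set Pt} (hU : IsOpen U) {X : Pt → V3} (hX : SV U X)
    (e : Pt) : SV U (DV e X) := fun i => smooth_Dd hU (hX i) e

lemma smooth_dot {U : Set Pt} {X Y : Pt → V3} (hX : SV U X) (hY : SV U Y) :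
    ContDiffOn ℝ (⊤ : ℕ∞) (fun p => dot3 (X p) (Y p)) U := by
  unfold dot3
  exact (((hX 0).mul (hY 0)).add ((hX 1).mul (hY 1))).add ((hX 2).mul (hY 2))

lemma diffAt {U : Set Pt} (hU : IsOpen U) {f : Pt → ℝ} (hf : ContDiffOn ℝ (⊤ : ℕ∞) f U)
    {p : Pt} (hp : p ∈ U) : DifferentiableAt ℝ f p :=
  (hf.contDiffAt (hU.mem_nhds hp)).differentiableAt (by simp)

lemma Dd_mul {U : Set Pt} (hU : IsOpen U) {f g : Pt → ℝ} (hf : ContDiffOn ℝ (⊤ : ℕ∞) f U)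
    (hg : ContDiffOn ℝ (⊤ : ℕ∞) g U) (e : Pt) {p : Pt} (hp : p ∈ U) :
    Dd e (fun q => f q * g q) p = Dd e f p * g p + f p * Dd e g p := by
  unfold Dd
  rw [fderiv_fun_mul (diffAt hU hf hp) (diffAt hU hg hp)]
  simp
  ring

lemma Dd_add {U : Set Pt} (hU : IsOpen U) {f g : Pt → ℝ} (hf : ContDiffOn ℝ (⊤ : ℕ∞) f U)
    (hg : ContDiffOn ℝ (⊤ : ℕ∞) g U) (e : Pt) {p : Pt} (hp : p ∈ U) :
    Dd e (fun q => f q + g q) p = Dd e f p + Dd e g p := by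
  unfold Dd
  rw [fderiv_fun_add (diffAt hU hf hp) (diffAt hU hg hp)]
  simp

lemma Dd_congr {U : Set Pt} (hU : IsOpen U) {f g : Pt → ℝ} (h : ∀ q ∈ U, f q = g q)
    (e : Pt) {p : Pt} (hp : p ∈ U) : Dd e f p = Dd e g p := by
  unfold Dd
  have : f =ᶠ[nhds p] g := by
    filter_upwards [hU.mem_nhds hp] with q hq using h q hq
  rw [this.fderiv_eq]

lemma Dd_const (c : ℝ) (e p : Pt) : Dd e (fun _ => c) p = 0 := by
  unfold Dd; simp

lemma Dd_dot {U : Set Pt} (hU : IsOpen U) {X Y : Pt → V3} (hX : SV U X) (hY : SV U Y)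
    (e : Pt) {p : Pt} (hp : p ∈ U) :
    Dd e (fun q => dot3 (X q) (Y q)) p = dot3 (DV e X p) (Y p) + dot3 (X p) (DV e Y p) := by
  unfold dot3
  rw [Dd_add hU (((hX 0).mul (hY 0)).add ((hX 1).mul (hY 1))) ((hX 2).mul (hY 2)) e hp,
    Dd_add hU ((hX 0).mul (hY 0)) ((hX 1).mul (hY 1)) e hp,
    Dd_mul hU (hX 0) (hY 0) e hp, Dd_mul hU (hX 1) (hY 1) e hp, Dd_mul hU (hX 2) (hY 2) e hp]
  unfold DV
  ring

lemma Dd_comm {U : Set Pt} (hU : IsOpen U) {f : Pt → ℝ} (hf : ContDiffOn ℝ (⊤ : ℕ∞) f U)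
    (e e' : Pt) {p : Pt} (hp : p ∈ U) : Dd e (Dd e' f) p = Dd e' (Dd e f) p := by
  have hc : ContDiffAt ℝ (⊤ : ℕ∞) f p := hf.contDiffAt (hU.mem_nhds hp)
  have hs : IsSymmSndFDerivAt ℝ f p := by
    apply hc.isSymmSndFDerivAt
    simp only [minSmoothness_of_isRCLikeNormedField]
    exact WithTop.coe_le_coe.2 le_top
  have hd : DifferentiableAt ℝ (fderiv ℝ f) p := by
    have h : ContDiffOn ℝ (⊤ : ℕ∞) (fderiv ℝ f) U := hf.fderiv_of_isOpen hU (by simp)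
    exact (h.contDiffAt (hU.mem_nhds hp)).differentiableAt (by simp)
  have key : ∀ a b : Pt, Dd a (Dd b f) p = fderiv ℝ (fderiv ℝ f) p a b := by
    intro a b
    unfold Dd
    rw [fderiv_clm_apply hd (differentiableAt_const b)]
    simp
  rw [key, key]
  exact hs.eq e e'

lemma DV_comm {U : Set Pt} (hU : IsOpen U) {X : Pt → V3} (hX : SV U X)
    (e e' : Pt) {p : Pt} (hp : p ∈ U) : DV e (DV e' X) p = DV e' (DV e X) p := by
  funext i
  exact Dd_comm hU (hX i) e e' hp

lemma DV_congr {U : Set Pt} (hU : IsOpen U) {X Y : Pt → V3} (h : ∀ q ∈ U, X q = Y q)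
    (e : Pt) {p : Pt} (hp : p ∈ U) : DV e X p = DV e Y p := by
  funext i
  exact Dd_congr hU (fun q hq => by rw [h q hq]) e hp

lemma dot_comm (x y : V3) : dot3 x y = dot3 y x := by unfold dot3; ring

lemma lagr (a b : V3) : dot3 (cross3 a b) (cross3 a b) =
    dot3 a a * dot3 b b - dot3 a b * dot3 a b := by
  simp [dot3, cross3]; ring

lemma cross_pos {a b : V3} (h : LinearIndependent ℝ ![a, b]) :
    0 < dot3 (cross3 a b) (cross3 a b) := by
  have hnn : 0 ≤ dot3 (cross3 a b) (cross3 a b) := by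
    unfold dot3
    have q := fun i => mul_self_nonneg (cross3 a b i)
    linarith [q 0, q 1, q 2]
  refine lt_of_le_of_ne hnn (fun h0 => ?_)
  rw [LinearIndependent.pair_iff] at h
  have hb : dot3 a b * dot3 a b = dot3 a a * dot3 b b := by
    have := lagr a b; linarith
  have hz : dot3 (cross3 a b) (cross3 a b) = 0 := h0.symm
  simp only [dot3, cross3, Matrix.cons_val_zero, Matrix.cons_val_one, Matrix.cons_val] at hz
  have z0 : a 1 * b 2 - a 2 * b 1 = 0 := by nlinarith [sq_nonneg (a 1 * b 2 - a 2 * b 1), sq_nonneg (a 2 * b 0 - a 0 * b 2), sq_nonneg (a 0 * b 1 - a 1 * b 0)]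
  have z1 : a 2 * b 0 - a 0 * b 2 = 0 := by nlinarith [sq_nonneg (a 1 * b 2 - a 2 * b 1), sq_nonneg (a 2 * b 0 - a 0 * b 2), sq_nonneg (a 0 * b 1 - a 1 * b 0)]
  have z2 : a 0 * b 1 - a 1 * b 0 = 0 := by nlinarith [sq_nonneg (a 1 * b 2 - a 2 * b 1), sq_nonneg (a 2 * b 0 - a 0 * b 2), sq_nonneg (a 0 * b 1 - a 1 * b 0)]
  have key : ∀ j : Fin 3, b j = 0 ∧ a j = 0 := by
    intro j
    have := h (b j) (-(a j)) (by
      funext k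
      simp only [Pi.add_apply, Pi.smul_apply, smul_eq_mul, Pi.zero_apply]
      fin_cases j <;> fin_cases k <;> simp <;> linarith)
    exact ⟨this.1, by linarith [this.2]⟩
  have := h 1 1 (by funext k; simp [(key k).1, (key k).2])
  exact one_ne_zero this.1

variable {U : Set Pt} {R : Pt → V3}

def Reg (U : Set Pt) (R : Pt → V3) : Prop :=
  IsOpen U ∧ SV U R ∧ ∀ p ∈ U, 0 < dot3 (cross3 (aV R 0 p) (aV R 1 p)) (cross3 (aV R 0 p) (aV R 1 p))

lemma aV_eq (R : Pt → V3) (α : Fin 2) : aV R α = DV (sdir α) R := rfl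

lemma smooth_a (h : Reg U R) (α : Fin 2) : SV U (aV R α) := smooth_DV h.1 h.2.1 _

lemma smooth_v (h : Reg U R) : SV U (vel R) := smooth_DV h.1 h.2.1 _

lemma smooth_cross {X Y : Pt → V3} (hX : SV U X) (hY : SV U Y) :
    SV U (fun p => cross3 (X p) (Y p)) := by
  intro i
  fin_cases i
  · exact ((hX 1).mul (hY 2)).sub ((hX 2).mul (hY 1))
  · exact ((hX 2).mul (hY 0)).sub ((hX 0).mul (hY 2))
  · exact ((hX 0).mul (hY 1)).sub ((hX 1).mul (hY 0))

lemma smooth_n (h : Reg U R) : SV U (nor R) := by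
  intro i
  have hc := smooth_cross (smooth_a h 0) (smooth_a h 1)
  have hd := smooth_dot hc hc
  unfold nor norm3
  refine (hc i).div (hd.sqrt (fun p hp => (h.2.2 p hp).ne')) (fun p hp => ?_)
  exact (Real.sqrt_pos.2 (h.2.2 p hp)).ne'

lemma smooth_met (h : Reg U R) (α β : Fin 2) : ContDiffOn ℝ (⊤ : ℕ∞) (met R α β) U :=
  smooth_dot (smooth_a h α) (smooth_a h β)

lemma met_symm (R : Pt → V3) (p : Pt) : met R 1 0 p = met R 0 1 p := dot_comm _ _

def dt (R : Pt → V3) (p : Pt) : ℝ := met R 0 0 p * met R 1 1 p - met R 0 1 p * met R 0 1 p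

lemma dt_pos (h : Reg U R) {p : Pt} (hp : p ∈ U) : 0 < dt R p := by
  have := h.2.2 p hp
  rwa [lagr] at this

lemma metInv_eq (R : Pt → V3) (p : Pt) :
    metInv R p 0 0 = met R 1 1 p / dt R p ∧ metInv R p 0 1 = - met R 0 1 p / dt R p ∧
    metInv R p 1 0 = - met R 0 1 p / dt R p ∧ metInv R p 1 1 = met R 0 0 p / dt R p := by
  have hdet : (Matrix.of fun α β => met R α β p).det = dt R p := by
    rw [Matrix.det_fin_two]; simp only [Matrix.of_apply, met_symm, dt]
  unfold metInv
  rw [Matrix.inv_def, hdet, Matrix.adjugate_fin_two]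
  simp only [Ring.inverse_eq_inv', Matrix.smul_apply, Matrix.of_apply, smul_eq_mul, met_symm,
    Matrix.cons_val_zero, Matrix.cons_val_one, Matrix.cons_val', Matrix.cons_val_fin_one]
  refine ⟨?_, ?_, ?_, ?_⟩ <;> ring

lemma smooth_g (h : Reg U R) (α β : Fin 2) :
    ContDiffOn ℝ (⊤ : ℕ∞) (fun p => metInv R p α β) U := by
  have hd : ContDiffOn ℝ (⊤ : ℕ∞) (dt R) U :=
    ((smooth_met h 0 0).mul (smooth_met h 1 1)).sub ((smooth_met h 0 1).mul (smooth_met h 0 1))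
  have hne : ∀ p ∈ U, dt R p ≠ 0 := fun p hp => (dt_pos h hp).ne'
  fin_cases α <;> fin_cases β
  · exact ((smooth_met h 1 1).div hd hne).congr (fun p _ => (metInv_eq R p).1)
  · exact ((smooth_met h 0 1).neg.div hd hne).congr (fun p _ => (metInv_eq R p).2.1)
  · exact ((smooth_met h 0 1).neg.div hd hne).congr (fun p _ => (metInv_eq R p).2.2.1)
  · exact ((smooth_met h 0 0).div hd hne).congr (fun p _ => (metInv_eq R p).2.2.2)

lemma g_symm (R : Pt → V3) (p : Pt) : metInv R p 1 0 = metInv R p 0 1 := by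
  rw [(metInv_eq R p).2.1, (metInv_eq R p).2.2.1]

lemma nor_apply (R : Pt → V3) (p : Pt) (i : Fin 3) :
    nor R p i = cross3 (aV R 0 p) (aV R 1 p) i / Real.sqrt (dt R p) := by
  have h1 : dot3 (cross3 (aV R 0 p) (aV R 1 p)) (cross3 (aV R 0 p) (aV R 1 p)) = dt R p := lagr _ _
  unfold nor norm3
  rw [h1]

lemma nor_sq (h : Reg U R) {p : Pt} (hp : p ∈ U) (x y : V3) :
    dot3 x (nor R p) * dot3 y (nor R p) =
      dot3 x (cross3 (aV R 0 p) (aV R 1 p)) * dot3 y (cross3 (aV R 0 p) (aV R 1 p)) / dt R p := by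
  have h1 : dot3 (cross3 (aV R 0 p) (aV R 1 p)) (cross3 (aV R 0 p) (aV R 1 p)) = dt R p := lagr _ _
  have hpos := dt_pos h hp
  have key : ∀ z : V3, dot3 z (nor R p) =
      dot3 z (cross3 (aV R 0 p) (aV R 1 p)) / Real.sqrt (dt R p) := by
    intro z
    unfold dot3
    simp only [nor_apply]
    ring
  rw [key, key, div_mul_div_comm, Real.mul_self_sqrt hpos.le]

lemma frame (h : Reg U R) {p : Pt} (hp : p ∈ U) (x y : V3) :
    dot3 x y = dot3 x (nor R p) * dot3 y (nor R p) +
      (metInv R p 0 0 * dot3 x (aV R 0 p) * dot3 y (aV R 0 p)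
      + metInv R p 0 1 * dot3 x (aV R 0 p) * dot3 y (aV R 1 p)
      + metInv R p 0 1 * dot3 x (aV R 1 p) * dot3 y (aV R 0 p)
      + metInv R p 1 1 * dot3 x (aV R 1 p) * dot3 y (aV R 1 p)) := by
  have hne := (dt_pos h hp).ne'
  rw [nor_sq h hp, (metInv_eq R p).1, (metInv_eq R p).2.1, (metInv_eq R p).2.2.2]
  field_simp
  unfold dt met
  generalize aV R 0 p = a
  generalize aV R 1 p = b
  simp [dot3, cross3]
  ring

lemma n_a (R : Pt → V3) (p : Pt) (α : Fin 2) : dot3 (nor R p) (aV R α p) = 0 := by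
  unfold nor
  generalize norm3 _ = s
  fin_cases α <;> simp [dot3, cross3] <;> ring

lemma n_n (h : Reg U R) {p : Pt} (hp : p ∈ U) : dot3 (nor R p) (nor R p) = 1 := by
  have h1 : dot3 (cross3 (aV R 0 p) (aV R 1 p)) (cross3 (aV R 0 p) (aV R 1 p)) = dt R p := lagr _ _
  have hpos := dt_pos h hp
  have hs : Real.sqrt (dt R p) * Real.sqrt (dt R p) = dt R p := Real.mul_self_sqrt hpos.le
  have hs0 : Real.sqrt (dt R p) ≠ 0 := (Real.sqrt_pos.2 hpos).ne'
  have e : dot3 (nor R p) (nor R p) = dot3 (cross3 (aV R 0 p) (aV R 1 p)) (cross3 (aV R 0 p) (aV R 1 p)) / (Real.sqrt (dt R p) * Real.sqrt (dt R p)) := by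
    unfold dot3
    simp only [nor_apply]
    field_simp
  rw [e, h1, hs, div_self hpos.ne']

lemma Dn_n (h : Reg U R) {p : Pt} (hp : p ∈ U) (e : Pt) : dot3 (DV e (nor R) p) (nor R p) = 0 := by
  have h1 := Dd_dot h.1 (smooth_n h) (smooth_n h) e hp
  rw [Dd_congr h.1 (g := fun _ => 1) (fun q hq => n_n h hq) e hp, Dd_const,
    dot_comm (nor R p)] at h1
  linarith

lemma Dn_a (h : Reg U R) {p : Pt} (hp : p ∈ U) (e : Pt) (α : Fin 2) :
    dot3 (DV e (nor R) p) (aV R α p) = - dot3 (DV e (aV R α) p) (nor R p) := by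
  have h1 := Dd_dot h.1 (smooth_n h) (smooth_a h α) e hp
  rw [Dd_congr h.1 (g := fun _ => 0) (fun q hq => n_a R q α) e hp, Dd_const,
    dot_comm (nor R p)] at h1
  linarith

/-- second derivatives of the normal, against the normal -/
lemma DDn_n (h : Reg U R) {p : Pt} (hp : p ∈ U) (e e' : Pt) :
    dot3 (DV e (DV e' (nor R)) p) (nor R p) = - dot3 (DV e' (nor R) p) (DV e (nor R) p) := by
  have h1 := Dd_dot h.1 (smooth_DV h.1 (smooth_n h) e') (smooth_n h) e hp
  rw [Dd_congr h.1 (g := fun _ => 0) (fun q hq => Dn_n h hq e') e hp, Dd_const] at h1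
  linarith

lemma DDn_a (h : Reg U R) {p : Pt} (hp : p ∈ U) (e e' : Pt) (α : Fin 2) :
    dot3 (DV e (DV e' (nor R)) p) (aV R α p) =
      - dot3 (DV e' (nor R) p) (DV e (aV R α) p) - dot3 (DV e (nor R) p) (DV e' (aV R α) p)
      - dot3 (DV e (DV e' (aV R α)) p) (nor R p) := by
  have s1 := smooth_DV h.1 (smooth_n h) e'
  have s2 := smooth_DV h.1 (smooth_a h α) e'
  have h1 := Dd_dot h.1 s1 (smooth_a h α) e hp
  have h2 := Dd_dot h.1 s2 (smooth_n h) e hp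
  have h3 := Dd_add h.1 (smooth_dot s1 (smooth_a h α)) (smooth_dot s2 (smooth_n h)) e hp
  rw [Dd_congr h.1 (g := fun _ => 0) (fun q hq => by rw [Dn_a h hq]; ring) e hp, Dd_const,
    h1, h2, dot_comm (DV e' (aV R α) p)] at h3
  linarith

lemma Dg (h : Reg U R) {p : Pt} (hp : p ∈ U) (e : Pt) :
    Dd e (fun q => metInv R q 0 0) p = -(metInv R p 0 0 ^ 2 * Dd e (met R 0 0) p
      + 2 * metInv R p 0 0 * metInv R p 0 1 * Dd e (met R 0 1) p
      + metInv R p 0 1 ^ 2 * Dd e (met R 1 1) p) ∧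
    Dd e (fun q => metInv R q 0 1) p = -(metInv R p 0 0 * metInv R p 0 1 * Dd e (met R 0 0) p
      + (metInv R p 0 0 * metInv R p 1 1 + metInv R p 0 1 ^ 2) * Dd e (met R 0 1) p
      + metInv R p 0 1 * metInv R p 1 1 * Dd e (met R 1 1) p) ∧
    Dd e (fun q => metInv R q 1 1) p = -(metInv R p 0 1 ^ 2 * Dd e (met R 0 0) p
      + 2 * metInv R p 1 1 * metInv R p 0 1 * Dd e (met R 0 1) p
      + metInv R p 1 1 ^ 2 * Dd e (met R 1 1) p) := by
  have rel : ∀ q ∈ U,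
      metInv R q 0 0 * met R 0 0 q + metInv R q 0 1 * met R 0 1 q = 1 ∧
      metInv R q 0 0 * met R 0 1 q + metInv R q 0 1 * met R 1 1 q = 0 ∧
      metInv R q 0 1 * met R 0 0 q + metInv R q 1 1 * met R 0 1 q = 0 ∧
      metInv R q 0 1 * met R 0 1 q + metInv R q 1 1 * met R 1 1 q = 1 := by
    intro q hq
    have hne := (dt_pos h hq).ne'
    rw [(metInv_eq R q).1, (metInv_eq R q).2.1, (metInv_eq R q).2.2.2]
    refine ⟨?_, ?_, ?_, ?_⟩ <;> field_simp <;> unfold dt <;> ring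
  have D2 : ∀ (f1 f2 m1 m2 : Pt → ℝ) (k : ℝ), ContDiffOn ℝ (⊤ : ℕ∞) f1 U →
      ContDiffOn ℝ (⊤ : ℕ∞) f2 U → ContDiffOn ℝ (⊤ : ℕ∞) m1 U → ContDiffOn ℝ (⊤ : ℕ∞) m2 U →
      (∀ q ∈ U, f1 q * m1 q + f2 q * m2 q = k) →
      Dd e f1 p * m1 p + f1 p * Dd e m1 p + (Dd e f2 p * m2 p + f2 p * Dd e m2 p) = 0 := by
    intro f1 f2 m1 m2 k s1 s2 s3 s4 hk
    rw [← Dd_mul h.1 s1 s3 e hp, ← Dd_mul h.1 s2 s4 e hp,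
      ← Dd_add h.1 (s1.mul s3) (s2.mul s4) e hp, Dd_congr h.1 hk e hp, Dd_const]
  have e1 := D2 _ _ _ _ _ (smooth_g h 0 0) (smooth_g h 0 1) (smooth_met h 0 0) (smooth_met h 0 1)
    (fun q hq => (rel q hq).1)
  have e2 := D2 _ _ _ _ _ (smooth_g h 0 0) (smooth_g h 0 1) (smooth_met h 0 1) (smooth_met h 1 1)
    (fun q hq => (rel q hq).2.1)
  have e3 := D2 _ _ _ _ _ (smooth_g h 0 1) (smooth_g h 1 1) (smooth_met h 0 0) (smooth_met h 0 1)
    (fun q hq => (rel q hq).2.2.1)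
  have e4 := D2 _ _ _ _ _ (smooth_g h 0 1) (smooth_g h 1 1) (smooth_met h 0 1) (smooth_met h 1 1)
    (fun q hq => (rel q hq).2.2.2)
  obtain ⟨r1, r2, r3, r4⟩ := rel p hp
  beta_reduce at e1 e2 e3 e4
  generalize Dd e (fun q => metInv R q 0 0) p = G0 at *
  generalize Dd e (fun q => metInv R q 0 1) p = G1 at *
  generalize Dd e (fun q => metInv R q 1 1) p = G2 at *
  generalize Dd e (met R 0 0) p = M0 at *
  generalize Dd e (met R 0 1) p = M1 at *
  generalize Dd e (met R 1 1) p = M2 at *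
  generalize metInv R p 0 0 = g0 at *
  generalize metInv R p 0 1 = g1 at *
  generalize metInv R p 1 1 = g2 at *
  generalize met R 0 0 p = m0 at *
  generalize met R 0 1 p = m1 at *
  generalize met R 1 1 p = m2 at *
  refine ⟨?_, ?_, ?_⟩
  · linear_combination g0 * e1 + g1 * e2 - G0 * r1 - G1 * r2
  · linear_combination g1 * e1 + g2 * e2 - G0 * r3 - G1 * r4
  · linear_combination g1 * e3 + g2 * e4 - G1 * r3 - G2 * r4

lemma b_symm (h : Reg U R) {p : Pt} (hp : p ∈ U) :
    DV (sdir 1) (aV R 0) p = DV (sdir 0) (aV R 1) p := DV_comm h.1 h.2.1 _ _ hp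

lemma smooth_b (h : Reg U R) (α β : Fin 2) : ContDiffOn ℝ (⊤ : ℕ∞) (bform R α β) U :=
  smooth_dot (smooth_DV h.1 (smooth_a h β) (sdir α)) (smooth_n h)

lemma D_met (h : Reg U R) {p : Pt} (hp : p ∈ U) (e : Pt) (α β : Fin 2) :
    Dd e (met R α β) p = dot3 (DV e (aV R α) p) (aV R β p) + dot3 (DV e (aV R β) p) (aV R α p) := by
  rw [dot_comm (DV e (aV R β) p)]
  exact Dd_dot h.1 (smooth_a h α) (smooth_a h β) e hp

lemma D_b (h : Reg U R) {p : Pt} (hp : p ∈ U) (e : Pt) (α β : Fin 2) :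
    Dd e (bform R α β) p = dot3 (DV e (DV (sdir α) (aV R β)) p) (nor R p)
      + dot3 (DV (sdir α) (aV R β) p) (DV e (nor R) p) :=
  Dd_dot h.1 (smooth_DV h.1 (smooth_a h β) (sdir α)) (smooth_n h) e hp

lemma D_H (h : Reg U R) {p : Pt} (hp : p ∈ U) (e : Pt) :
    2 * Dd e (meanH R) p =
      (Dd e (fun q => metInv R q 0 0) p * bform R 0 0 p + metInv R p 0 0 * Dd e (bform R 0 0) p)
      + 2 * (Dd e (fun q => metInv R q 0 1) p * bform R 0 1 p + metInv R p 0 1 * Dd e (bform R 0 1) p)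
      + (Dd e (fun q => metInv R q 1 1) p * bform R 1 1 p + metInv R p 1 1 * Dd e (bform R 1 1) p) := by
  have s0 := (smooth_g h 0 0).mul (smooth_b h 0 0)
  have s1 := (smooth_g h 0 1).mul (smooth_b h 0 1)
  have s2 := (smooth_g h 1 1).mul (smooth_b h 1 1)
  have c1 : ContDiffOn ℝ (⊤ : ℕ∞) (fun _ : Pt => (1/2 : ℝ)) U := contDiffOn_const
  have e1 : ∀ q ∈ U, meanH R q = (1/2 : ℝ) * (metInv R q 0 0 * bform R 0 0 q) +
      metInv R q 0 1 * bform R 0 1 q + (1/2 : ℝ) * (metInv R q 1 1 * bform R 1 1 q) := by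
    intro q hq
    have hb : bform R 1 0 q = bform R 0 1 q := by
      change dot3 (DV (sdir 1) (aV R 0) q) _ = dot3 (DV (sdir 0) (aV R 1) q) _
      rw [b_symm h hq]
    simp only [meanH, Fin.sum_univ_two, g_symm, hb]
    ring
  rw [Dd_congr h.1 e1 e hp, Dd_add h.1 ((c1.mul s0).add s1) (c1.mul s2) e hp,
    Dd_add h.1 (c1.mul s0) s1 e hp, Dd_mul h.1 c1 s0 e hp, Dd_mul h.1 c1 s2 e hp,
    Dd_mul h.1 (smooth_g h 0 0) (smooth_b h 0 0) e hp,
    Dd_mul h.1 (smooth_g h 0 1) (smooth_b h 0 1) e hp,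
    Dd_mul h.1 (smooth_g h 1 1) (smooth_b h 1 1) e hp, Dd_const]
  ring

lemma D_vN (h : Reg U R) {p : Pt} (hp : p ∈ U) (e : Pt) :
    Dd e (vN R) p = dot3 (DV e (vel R) p) (nor R p) + dot3 (vel R p) (DV e (nor R) p) :=
  Dd_dot h.1 (smooth_v h) (smooth_n h) e hp

lemma DD_vN (h : Reg U R) {p : Pt} (hp : p ∈ U) (e e' : Pt) :
    Dd e (Dd e' (vN R)) p = dot3 (DV e (DV e' (vel R)) p) (nor R p)
      + dot3 (DV e' (vel R) p) (DV e (nor R) p)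
      + dot3 (DV e (vel R) p) (DV e' (nor R) p) + dot3 (vel R p) (DV e (DV e' (nor R)) p) := by
  have sv := smooth_v h
  have sn := smooth_n h
  have sv' := smooth_DV h.1 sv e'
  have sn' := smooth_DV h.1 sn e'
  rw [Dd_congr h.1 (fun q hq => D_vN h hq e') e hp,
    Dd_add h.1 (smooth_dot sv' sn) (smooth_dot sv sn') e hp, Dd_dot h.1 sv' sn e hp,
    Dd_dot h.1 sv sn' e hp]
  ring

def et : Pt := ((0,0),1)

lemma main (h : Reg U R) {p : Pt} (hp : p ∈ U) :
      2 * pdT (meanH R) p =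
        (∑ α : Fin 2, ∑ β : Fin 2, metInv R p α β * vNCov2 R α β p)
          + vN R p * (∑ α : Fin 2, ∑ β : Fin 2, bMix R α β p * bMix R β α p)
          + 2 * ∑ α : Fin 2, vUp R α p * pdS α (meanH R) p := by
  -- commutation facts
  have hv : ∀ α, DV (sdir α) (vel R) p = DV et (aV R α) p := fun α =>
    DV_comm h.1 h.2.1 _ _ hp
  have hvv : ∀ α β, DV (sdir β) (DV (sdir α) (vel R)) p = DV et (DV (sdir β) (aV R α)) p := by
    intro α β
    have c : ∀ q ∈ U, DV (sdir α) (vel R) q = DV et (aV R α) q :=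
      fun q hq => DV_comm h.1 h.2.1 _ _ hq
    rw [DV_congr h.1 c (sdir β) hp]
    exact DV_comm h.1 (smooth_a h α) _ _ hp
  have hb := b_symm h hp
  have hb3 : ∀ e, DV e (DV (sdir 1) (aV R 0)) p = DV e (DV (sdir 0) (aV R 1)) p := fun e =>
    DV_congr h.1 (fun q hq => b_symm h hq) e hp
  have q1 : DV (sdir 1) (DV (sdir 0) (aV R 0)) p = DV (sdir 0) (DV (sdir 0) (aV R 1)) p := by
    rw [DV_comm h.1 (smooth_a h 0) _ _ hp, hb3]
  have q2 : DV (sdir 1) (DV (sdir 0) (aV R 1)) p = DV (sdir 0) (DV (sdir 1) (aV R 1)) p :=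
    DV_comm h.1 (smooth_a h 1) _ _ hp
  have bdef : ∀ α β, bform R α β p = dot3 (DV (sdir α) (aV R β) p) (nor R p) := fun _ _ => rfl
  have H0 := D_H h hp (sdir 0)
  have H1 := D_H h hp (sdir 1)
  have Ht := D_H h hp et
  have R1 : 2 * ∑ α : Fin 2, vUp R α p * pdS α (meanH R) p =
      vUp R 0 p * (2 * Dd (sdir 0) (meanH R) p) + vUp R 1 p * (2 * Dd (sdir 1) (meanH R) p) := by
    change 2 * ∑ α : Fin 2, vUp R α p * Dd (sdir α) (meanH R) p = _
    rw [Fin.sum_univ_two]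
    ring
  have L1 : 2 * pdT (meanH R) p = 2 * Dd et (meanH R) p := rfl
  have K : ∀ α β, vNCov2 R α β p = Dd (sdir β) (Dd (sdir α) (vN R)) p
    - ∑ γ : Fin 2, chris R γ α β p * Dd (sdir γ) (vN R) p := fun _ _ => rfl
  have C : ∀ γ α β, chris R γ α β p = ∑ δ : Fin 2, metInv R p γ δ *
      dot3 (DV (sdir α) (aV R β) p) (aV R δ p) := by
    intro γ α β
    have : ∀ δ, pdS α (met R β δ) p + pdS β (met R α δ) p - pdS δ (met R α β) p =
        2 * dot3 (DV (sdir α) (aV R β) p) (aV R δ p) := by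
      intro δ
      change Dd (sdir α) (met R β δ) p + Dd (sdir β) (met R α δ) p - Dd (sdir δ) (met R α β) p = _
      have c : ∀ x y, DV (sdir x) (aV R y) p = DV (sdir y) (aV R x) p :=
        fun x y => DV_comm h.1 h.2.1 _ _ hp
      rw [D_met h hp, D_met h hp, D_met h hp, c δ α, c δ β, c β α]
      ring
    simp only [chris, this, Finset.mul_sum]
    exact Finset.sum_congr rfl (fun δ _ => by ring)
  -- frame expansions
  have F1 : ∀ e α e', dot3 (DV e (aV R α) p) (DV e' (nor R) p) =
      -(metInv R p 0 0 * dot3 (DV e (aV R α) p) (aV R 0 p) * dot3 (DV e' (aV R 0) p) (nor R p)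
      + metInv R p 0 1 * dot3 (DV e (aV R α) p) (aV R 0 p) * dot3 (DV e' (aV R 1) p) (nor R p)
      + metInv R p 0 1 * dot3 (DV e (aV R α) p) (aV R 1 p) * dot3 (DV e' (aV R 0) p) (nor R p)
      + metInv R p 1 1 * dot3 (DV e (aV R α) p) (aV R 1 p) * dot3 (DV e' (aV R 1) p) (nor R p)) := by
    intro e α e'
    rw [frame h hp, Dn_n h hp, Dn_a h hp, Dn_a h hp]
    ring
  have F2 : ∀ e', dot3 (vel R p) (DV e' (nor R) p) =
      -(metInv R p 0 0 * dot3 (vel R p) (aV R 0 p) * dot3 (DV e' (aV R 0) p) (nor R p)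
      + metInv R p 0 1 * dot3 (vel R p) (aV R 0 p) * dot3 (DV e' (aV R 1) p) (nor R p)
      + metInv R p 0 1 * dot3 (vel R p) (aV R 1 p) * dot3 (DV e' (aV R 0) p) (nor R p)
      + metInv R p 1 1 * dot3 (vel R p) (aV R 1 p) * dot3 (DV e' (aV R 1) p) (nor R p)) := by
    intro e'
    rw [frame h hp, Dn_n h hp, Dn_a h hp, Dn_a h hp]
    ring
  have F3 : ∀ e e', dot3 (DV e (nor R) p) (DV e' (nor R) p) =
      (metInv R p 0 0 * dot3 (DV e (aV R 0) p) (nor R p) * dot3 (DV e' (aV R 0) p) (nor R p)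
      + metInv R p 0 1 * dot3 (DV e (aV R 0) p) (nor R p) * dot3 (DV e' (aV R 1) p) (nor R p)
      + metInv R p 0 1 * dot3 (DV e (aV R 1) p) (nor R p) * dot3 (DV e' (aV R 0) p) (nor R p)
      + metInv R p 1 1 * dot3 (DV e (aV R 1) p) (nor R p) * dot3 (DV e' (aV R 1) p) (nor R p)) := by
    intro e e'
    rw [frame h hp, Dn_n h hp, Dn_a h hp, Dn_a h hp, Dn_a h hp, Dn_a h hp]
    ring
  have F1' : ∀ e α e', dot3 (DV e' (nor R) p) (DV e (aV R α) p) =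
      dot3 (DV e (aV R α) p) (DV e' (nor R) p) := fun _ _ _ => dot_comm _ _
  have F4 : ∀ e e', dot3 (vel R p) (DV e (DV e' (nor R)) p) =
      vN R p * dot3 (DV e (DV e' (nor R)) p) (nor R p) +
      (metInv R p 0 0 * dot3 (vel R p) (aV R 0 p) * dot3 (DV e (DV e' (nor R)) p) (aV R 0 p)
      + metInv R p 0 1 * dot3 (vel R p) (aV R 0 p) * dot3 (DV e (DV e' (nor R)) p) (aV R 1 p)
      + metInv R p 0 1 * dot3 (vel R p) (aV R 1 p) * dot3 (DV e (DV e' (nor R)) p) (aV R 0 p)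
      + metInv R p 1 1 * dot3 (vel R p) (aV R 1 p) * dot3 (DV e (DV e' (nor R)) p) (aV R 1 p)) :=
    fun e e' => frame h hp _ _
  obtain ⟨t0, t1, t2⟩ := Dg h hp et
  obtain ⟨x0, x1, x2⟩ := Dg h hp (sdir 0)
  obtain ⟨y0, y1, y2⟩ := Dg h hp (sdir 1)
  rw [x0, x1, x2] at H0
  rw [y0, y1, y2] at H1
  rw [L1, Ht, t0, t1, t2, R1, H0, H1]
  simp only [K, C, vUp, bMix, Fin.sum_univ_two, g_symm, D_met h hp, D_b h hp, D_vN h hp,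
    DD_vN h hp, hv, hvv, F4, DDn_n h hp, DDn_a h hp, F1', F1, F2, F3, bdef, hb, hb3, q1, q2]
  ring

end helpers

/-- evolution of the mean curvature, equation
`eq:mean curvature evolution`:
`2 ∂_t H = a^{αβ} vⁿ_{,αβ} + vⁿ b^α_β b^β_α + 2 v^α ∂_α H` on `Ω × I`. -/
theorem statement15 (Ω : Set (ℝ × ℝ)) (I : Set ℝ)
    (hΩ : IsOpen Ω) (hIo : IsOpen I) (hIc : I.OrdConnected)
    (R : Pt → V3)
    (hR : ∀ i : Fin 3, ContDiffOn ℝ (⊤ : ℕ∞) (fun p => R p i) (Ω ×ˢ I))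
    (hind : ∀ p ∈ Ω ×ˢ I, LinearIndependent ℝ ![aV R 0 p, aV R 1 p]) :
    ∀ p ∈ Ω ×ˢ I,
      2 * pdT (meanH R) p =
        (∑ α : Fin 2, ∑ β : Fin 2, metInv R p α β * vNCov2 R α β p)
          + vN R p * (∑ α : Fin 2, ∑ β : Fin 2, bMix R α β p * bMix R β α p)
          + 2 * ∑ α : Fin 2, vUp R α p * pdS α (meanH R) p := by
  have hU : IsOpen (Ω ×ˢ I) := hΩ.prod hIo
  exact fun p hp => main (U := Ω ×ˢ I) ⟨hU, hR, fun q hq => cross_pos (hind q hq)⟩ hp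
end
end

section
/- For a smooth isothermal immersion R : Ω → ℝ³, the first fundamental coefficient E satisfies ΔE = 2(∂₁∂₂R·∂₁∂₂R − ∂₁∂₁R·∂₂∂₂R). -/
noncomputable section

open scoped Real

/-- Partial derivative `∂₁` of a scalar function on ℝ². -/
def pd1 (f : ℝ × ℝ → ℝ) : ℝ × ℝ → ℝ := fun x => fderiv ℝ f x (1, 0)

/-- Partial derivative `∂₂` of a scalar function on ℝ². -/
def pd2 (f : ℝ × ℝ → ℝ) : ℝ × ℝ → ℝ := fun x => fderiv ℝ f x (0, 1)

/-- The flat Laplacian `Δ = ∂₁² + ∂₂²`. -/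
def lap (f : ℝ × ℝ → ℝ) : ℝ × ℝ → ℝ := fun x => pd1 (pd1 f) x + pd2 (pd2 f) x

def pd1v (R : ℝ × ℝ → V3) : ℝ × ℝ → V3 := fun x i => pd1 (fun y => R y i) x
def pd2v (R : ℝ × ℝ → V3) : ℝ × ℝ → V3 := fun x i => pd2 (fun y => R y i) x

/-- First fundamental coefficient `E = ∂₁R·∂₁R`. -/
def Efun (R : ℝ × ℝ → V3) : ℝ × ℝ → ℝ := fun x => dot3 (pd1v R x) (pd1v R x)

/-- The unit normal `n = (∂₁R×∂₂R)/|∂₁R×∂₂R|`. -/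
def nvec (R : ℝ × ℝ → V3) : ℝ × ℝ → V3 := fun x i =>
  cross3 (pd1v R x) (pd2v R x) i /
    Real.sqrt (dot3 (cross3 (pd1v R x) (pd2v R x)) (cross3 (pd1v R x) (pd2v R x)))

/-- `L = ∂₁∂₁R·n`. -/
def Lfun (R : ℝ × ℝ → V3) : ℝ × ℝ → ℝ := fun x => dot3 (pd1v (pd1v R) x) (nvec R x)
/-- `M = ∂₁∂₂R·n`. -/
def Mfun (R : ℝ × ℝ → V3) : ℝ × ℝ → ℝ := fun x => dot3 (pd1v (pd2v R) x) (nvec R x)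
/-- `N = ∂₂∂₂R·n`. -/
def Nfun (R : ℝ × ℝ → V3) : ℝ × ℝ → ℝ := fun x => dot3 (pd2v (pd2v R) x) (nvec R x)

/-- Mean curvature `H = (L+N)/(2E)` of an isothermal immersion. -/
def meanCurv (R : ℝ × ℝ → V3) : ℝ × ℝ → ℝ := fun x =>
  (Lfun R x + Nfun R x) / (2 * Efun R x)

/-- `R` is an isothermal immersion on `Ω`: `E = G > 0`, `F = 0`, and the tangent
vectors are linearly independent. -/
def IsIsothermalImmersionOn (R : ℝ × ℝ → V3) (Ω : Set (ℝ × ℝ)) : Prop :=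
  ∀ x ∈ Ω,
    dot3 (pd1v R x) (pd1v R x) = dot3 (pd2v R x) (pd2v R x) ∧
    dot3 (pd1v R x) (pd2v R x) = 0 ∧
    0 < dot3 (pd1v R x) (pd1v R x) ∧
    LinearIndependent ℝ ![pd1v R x, pd2v R x]

section helpers17

theorem h17_smooth {Ω : Set (ℝ × ℝ)} (hΩ : IsOpen Ω) {f : ℝ × ℝ → ℝ}
    (hf : ContDiffOn ℝ (⊤ : ℕ∞) f Ω) (v : ℝ × ℝ) :
    ContDiffOn ℝ (⊤ : ℕ∞) (fun x => fderiv ℝ f x v) Ω :=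
  (hf.fderiv_of_isOpen (m := (⊤ : ℕ∞)) hΩ (by simp)).clm_apply contDiffOn_const

theorem h17_diff {Ω : Set (ℝ × ℝ)} (hΩ : IsOpen Ω) {f : ℝ × ℝ → ℝ}
    (hf : ContDiffOn ℝ (⊤ : ℕ∞) f Ω) {x : ℝ × ℝ} (hx : x ∈ Ω) :
    DifferentiableAt ℝ f x :=
  (hf.contDiffAt (hΩ.mem_nhds hx)).differentiableAt (by simp)

theorem h17_congr {Ω : Set (ℝ × ℝ)} (hΩ : IsOpen Ω) {f g : ℝ × ℝ → ℝ}
    (h : ∀ x ∈ Ω, f x = g x) (v : ℝ × ℝ) :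
    ∀ x ∈ Ω, fderiv ℝ f x v = fderiv ℝ g x v := by
  intro x hx
  have : f =ᶠ[nhds x] g := Filter.eventuallyEq_of_mem (hΩ.mem_nhds hx) h
  rw [this.fderiv_eq]

theorem h17_symm {Ω : Set (ℝ × ℝ)} (hΩ : IsOpen Ω) {f : ℝ × ℝ → ℝ}
    (hf : ContDiffOn ℝ (⊤ : ℕ∞) f Ω) (v w : ℝ × ℝ) :
    ∀ x ∈ Ω, fderiv ℝ (fun y => fderiv ℝ f y v) x w
      = fderiv ℝ (fun y => fderiv ℝ f y w) x v := by
  intro x hx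
  have hc := hf.contDiffAt (hΩ.mem_nhds hx)
  have hs : IsSymmSndFDerivAt ℝ f x := hc.isSymmSndFDerivAt (by
    rw [minSmoothness_of_isRCLikeNormedField]
    exact WithTop.coe_le_coe.2 (le_top : (2 : ℕ∞) ≤ ⊤))
  have hd : DifferentiableAt ℝ (fderiv ℝ f) x :=
    (((hf.fderiv_of_isOpen (m := (⊤ : ℕ∞)) hΩ (by simp))).contDiffAt
      (hΩ.mem_nhds hx)).differentiableAt (by simp)
  rw [fderiv_clm_apply hd (differentiableAt_const _), fderiv_clm_apply hd (differentiableAt_const _)]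
  simpa using hs w v

theorem h17_dot {Ω : Set (ℝ × ℝ)} (hΩ : IsOpen Ω) {f g : Fin 3 → ℝ × ℝ → ℝ}
    (hf : ∀ i, ContDiffOn ℝ (⊤ : ℕ∞) (f i) Ω) (hg : ∀ i, ContDiffOn ℝ (⊤ : ℕ∞) (g i) Ω)
    (v : ℝ × ℝ) : ∀ x ∈ Ω,
    fderiv ℝ (fun y => ∑ i, f i y * g i y) x v
      = ∑ i, fderiv ℝ (f i) x v * g i x + ∑ i, f i x * fderiv ℝ (g i) x v := by
  intro x hx
  have h : HasFDerivAt (fun y => ∑ i, f i y * g i y)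
      (∑ i, (f i x • fderiv ℝ (g i) x + g i x • fderiv ℝ (f i) x)) x :=
    HasFDerivAt.fun_sum fun i _ =>
      (h17_diff hΩ (hf i) hx).hasFDerivAt.mul (h17_diff hΩ (hg i) hx).hasFDerivAt
  rw [h.fderiv]
  simp [Fin.sum_univ_three]
  ring

theorem h17_sdot {Ω : Set (ℝ × ℝ)} {f g : Fin 3 → ℝ × ℝ → ℝ}
    (hf : ∀ i, ContDiffOn ℝ (⊤ : ℕ∞) (f i) Ω) (hg : ∀ i, ContDiffOn ℝ (⊤ : ℕ∞) (g i) Ω) :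
    ContDiffOn ℝ (⊤ : ℕ∞) (fun y => ∑ i, f i y * g i y) Ω :=
  ContDiffOn.sum fun i _ => (hf i).mul (hg i)

/-- second derivative of a dot product -/
theorem h17_dot2 {Ω : Set (ℝ × ℝ)} (hΩ : IsOpen Ω) {f g : Fin 3 → ℝ × ℝ → ℝ}
    (hf : ∀ i, ContDiffOn ℝ (⊤ : ℕ∞) (f i) Ω) (hg : ∀ i, ContDiffOn ℝ (⊤ : ℕ∞) (g i) Ω)
    (v w : ℝ × ℝ) : ∀ x ∈ Ω,
    fderiv ℝ (fun z => fderiv ℝ (fun y => ∑ i, f i y * g i y) z v) x w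
      = (∑ i, fderiv ℝ (fun z => fderiv ℝ (f i) z v) x w * g i x
        + ∑ i, fderiv ℝ (f i) x v * fderiv ℝ (g i) x w)
        + (∑ i, fderiv ℝ (f i) x w * fderiv ℝ (g i) x v
        + ∑ i, f i x * fderiv ℝ (fun z => fderiv ℝ (g i) z v) x w) := by
  intro x hx
  have hf' := fun i => h17_smooth hΩ (hf i) v
  have hg' := fun i => h17_smooth hΩ (hg i) v
  rw [h17_congr hΩ (h17_dot hΩ hf hg v) w x hx,
    fderiv_fun_add (h17_diff hΩ (h17_sdot hf' hg) hx) (h17_diff hΩ (h17_sdot hf hg') hx),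
    add_apply, h17_dot hΩ hf' hg w x hx, h17_dot hΩ hf hg' w x hx]

end helpers17

/-- equation `eq:E-elliptic equation`: for a smooth isothermal
immersion `R : Ω → ℝ³`, the first fundamental coefficient satisfies
`ΔE = 2(∂₁∂₂R·∂₁∂₂R − ∂₁∂₁R·∂₂∂₂R)`. -/
theorem statement17 (Ω : Set (ℝ × ℝ)) (hΩ : IsOpen Ω) (R : ℝ × ℝ → V3)
    (hR : ∀ i : Fin 3, ContDiffOn ℝ (⊤ : ℕ∞) (fun x => R x i) Ω)
    (hiso : IsIsothermalImmersionOn R Ω) :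
    ∀ x ∈ Ω,
      lap (Efun R) x =
        2 * (dot3 (pd1v (pd2v R) x) (pd1v (pd2v R) x)
              - dot3 (pd1v (pd1v R) x) (pd2v (pd2v R) x)) := by
  intro x hx
  have hE : Efun R = fun y => ∑ i, fderiv ℝ (fun z => R z i) y (1, 0)
      * fderiv ℝ (fun z => R z i) y (1, 0) := by
    funext y; simp [Efun, dot3, pd1v, pd1, Fin.sum_univ_three]
  have hG : ∀ y ∈ Ω, Efun R y = (fun y => ∑ i, fderiv ℝ (fun z => R z i) y (0, 1)
      * fderiv ℝ (fun z => R z i) y (0, 1)) y := by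
    intro y hy
    have := (hiso y hy).1
    simpa [Efun, dot3, pd1v, pd1, pd2v, pd2, Fin.sum_univ_three] using this
  have hF : ∀ y ∈ Ω, (fun y => ∑ i, fderiv ℝ (fun z => R z i) y (1, 0)
      * fderiv ℝ (fun z => R z i) y (0, 1)) y = (fun _ => (0 : ℝ)) y := by
    intro y hy
    have := (hiso y hy).2.1
    simpa [dot3, pd1v, pd1, pd2v, pd2, Fin.sum_univ_three] using this
  have h1 := fun i => h17_smooth hΩ (hR i) (1, 0)
  have h2 := fun i => h17_smooth hΩ (hR i) (0, 1)
  have e11 := h17_congr hΩ (h17_congr hΩ hG (1, 0)) (1, 0) x hx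
  rw [h17_dot2 hΩ h2 h2 (1, 0) (1, 0) x hx] at e11
  have e22 := h17_dot2 hΩ h1 h1 (0, 1) (0, 1) x hx
  rw [← hE] at e22
  have e12 := h17_congr hΩ (h17_congr hΩ hF (0, 1)) (1, 0) x hx
  rw [h17_dot2 hΩ h1 h2 (0, 1) (1, 0) x hx] at e12
  have s := fun i => h17_symm hΩ (hR i) (1, 0) (0, 1)
  have s1 := fun i => h17_congr hΩ (s i) (1, 0) x hx
  have s2 := fun i => (h17_congr hΩ (s i) (0, 1) x hx).trans
    (h17_symm hΩ (h2 i) (1, 0) (0, 1) x hx)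
  have s0 := fun i => s i x hx
  simp only [s0, s1, s2, Fin.sum_univ_three] at e11 e22 e12
  simp only [lap, pd1, pd2, pd1v, pd2v, dot3]
  have p1 : pd1 (Efun R) = fun z => fderiv ℝ (Efun R) z (1, 0) := rfl
  have p2 : pd2 (Efun R) = fun z => fderiv ℝ (Efun R) z (0, 1) := rfl
  have z0 : fderiv ℝ (fun y : ℝ × ℝ => fderiv ℝ (fun _ : ℝ × ℝ => (0 : ℝ)) y (0, 1)) x (1, 0)
      = 0 := by simp
  rw [z0] at e12
  rw [p1, p2, e11, e22]
  linarith
end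
end

section
/- Suppose that at time t₀ the map R(·,t₀) is an isothermal immersion (E := ∂₁R·∂₁R = ∂₂R·∂₂R > 0 and ∂₁R·∂₂R = 0 at t₀) and that the velocity at time t₀ has the form ∂_tR = Uⁿn + W₁·∂₁R/√E + W₂·∂₂R/√E. Then at time t₀ one has ∂_t(∂₁R·∂₁R − ∂₂R·∂₂R) = 0 and ∂_t(∂₁R·∂₂R) = 0 at every point if and only if (W₁,W₂) satisfies the elliptic system ∂₁(W₁/√E) − ∂₂(W₂/√E) = Uⁿ(L−N)/E and ∂₂(W₁/√E) + ∂₁(W₂/√E) = 2UⁿM/E at every point. -/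
noncomputable section

open scoped Real BigOperators

variable (R : Pt → V3)

lemma s18_dd (f : Pt → ℝ) (p u w : Pt) (hf : ContDiffAt ℝ (⊤ : ℕ∞) f p) :
    DifferentiableAt ℝ (fun q => fderiv ℝ f q u) p ∧
    fderiv ℝ (fun q => fderiv ℝ f q u) p w = fderiv ℝ (fun q => fderiv ℝ f q w) p u := by
  have h1 : DifferentiableAt ℝ (fderiv ℝ f) p :=
    (hf.fderiv_right (m := 1) (by norm_cast)).differentiableAt (by norm_num)
  have hs : IsSymmSndFDerivAt ℝ f p := hf.isSymmSndFDerivAt (by simp; norm_cast)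
  have key : ∀ u : Pt, HasFDerivAt (fun q => fderiv ℝ f q u)
      ((fderiv ℝ (fderiv ℝ f) p).flip u) p := by
    intro u
    have := h1.hasFDerivAt.clm_apply (hasFDerivAt_const u p)
    rwa [ContinuousLinearMap.comp_zero, zero_add] at this
  refine ⟨(key u).differentiableAt, ?_⟩
  rw [(key u).fderiv, (key w).fderiv]
  exact hs w u

lemma s18_slice (f : Pt → ℝ) (x : ℝ × ℝ) (t : ℝ) (hf : DifferentiableAt ℝ f (x, t)) :
    HasFDerivAt (fun y => f (y, t))
      ((fderiv ℝ f (x, t)).comp (ContinuousLinearMap.inl ℝ (ℝ × ℝ) ℝ)) x :=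
  hf.hasFDerivAt.comp x (hasFDerivAt_prodMk_left x t)

lemma s18_dot {X : Type*} [NormedAddCommGroup X] [NormedSpace ℝ X] (a b : X → V3) (x d : X)
    (a' b' : Fin 3 → (X →L[ℝ] ℝ))
    (ha : ∀ i, HasFDerivAt (fun y => a y i) (a' i) x)
    (hb : ∀ i, HasFDerivAt (fun y => b y i) (b' i) x) :
    DifferentiableAt ℝ (fun y => dot3 (a y) (b y)) x ∧
    fderiv ℝ (fun y => dot3 (a y) (b y)) x d =
      dot3 (fun i => a' i d) (b x) + dot3 (a x) (fun i => b' i d) := by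
  have h := (((ha 0).mul (hb 0)).add ((ha 1).mul (hb 1))).add ((ha 2).mul (hb 2))
  have h' : HasFDerivAt (fun y => dot3 (a y) (b y)) _ x := h
  refine ⟨h'.differentiableAt, ?_⟩
  rw [h'.fderiv]
  simp [dot3]
  ring

lemma s18_nor (R : Pt → V3) (p : Pt) :
    dot3 (nor R p) (aV R 0 p) = 0 ∧ dot3 (nor R p) (aV R 1 p) = 0 := by
  constructor <;> · simp [dot3, nor, cross3]; ring

lemma s18_comm (a b : V3) : dot3 a b = dot3 b a := by simp only [dot3]; ring

lemma s18_lin (U w z : ℝ) (v n a b c : V3) (h : ∀ i, v i = U * n i + w * a i + z * b i) :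
    dot3 v c = U * dot3 n c + w * dot3 a c + z * dot3 b c := by
  simp only [dot3, h]; ring

/-- derivation of the elliptic system `eq:tangential-elliptic system`:
if at time `t₀` the surface is isothermal and the velocity has the form
`∂_tR = Uⁿn + W₁∂₁R/√E + W₂∂₂R/√E`, then `∂_t(E−G) = 0` and `∂_tF = 0` everywhere at
time `t₀` iff `(W₁,W₂)` solves `∂₁(W₁/√E) − ∂₂(W₂/√E) = Uⁿ(L−N)/E`,
`∂₂(W₁/√E) + ∂₁(W₂/√E) = 2UⁿM/E` everywhere. -/
theorem statement18 (Ω : Set (ℝ × ℝ)) (I : Set ℝ)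
    (hΩ : IsOpen Ω) (hIo : IsOpen I) (hIc : I.OrdConnected)
    (R : Pt → V3)
    (hR : ∀ i : Fin 3, ContDiffOn ℝ (⊤ : ℕ∞) (fun p => R p i) (Ω ×ˢ I))
    (hind : ∀ p ∈ Ω ×ˢ I, LinearIndependent ℝ ![aV R 0 p, aV R 1 p])
    (t₀ : ℝ) (ht₀ : t₀ ∈ I)
    (hiso : ∀ x ∈ Ω,
      met R 0 0 (x, t₀) = met R 1 1 (x, t₀) ∧
      met R 0 1 (x, t₀) = 0 ∧
      0 < met R 0 0 (x, t₀))
    (Un W₁ W₂ : ℝ × ℝ → ℝ)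
    (hUn : ContDiffOn ℝ (⊤ : ℕ∞) Un Ω) (hW₁ : ContDiffOn ℝ (⊤ : ℕ∞) W₁ Ω) (hW₂ : ContDiffOn ℝ (⊤ : ℕ∞) W₂ Ω)
    (hvel : ∀ x ∈ Ω, ∀ i : Fin 3,
      vel R (x, t₀) i =
        Un x * nor R (x, t₀) i +
          W₁ x * aV R 0 (x, t₀) i / Real.sqrt (met R 0 0 (x, t₀)) +
          W₂ x * aV R 1 (x, t₀) i / Real.sqrt (met R 0 0 (x, t₀))) :
    ((∀ x ∈ Ω,
        pdT (fun q => met R 0 0 q - met R 1 1 q) (x, t₀) = 0 ∧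
        pdT (met R 0 1) (x, t₀) = 0)
      ↔
      (∀ x ∈ Ω,
        pd1 (fun y => W₁ y / Real.sqrt (met R 0 0 (y, t₀))) x -
            pd2 (fun y => W₂ y / Real.sqrt (met R 0 0 (y, t₀))) x =
          Un x * (bform R 0 0 (x, t₀) - bform R 1 1 (x, t₀)) / met R 0 0 (x, t₀) ∧
        pd2 (fun y => W₁ y / Real.sqrt (met R 0 0 (y, t₀))) x +
            pd1 (fun y => W₂ y / Real.sqrt (met R 0 0 (y, t₀))) x =
          2 * Un x * bform R 0 1 (x, t₀) / met R 0 0 (x, t₀))) := by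
  have hnhds : ∀ x ∈ Ω, Ω ×ˢ I ∈ nhds ((x, t₀) : Pt) := fun x hx =>
    (hΩ.prod hIo).mem_nhds ⟨hx, ht₀⟩
  have hsm : ∀ x ∈ Ω, ∀ i, ContDiffAt ℝ (⊤ : ℕ∞) (fun p => R p i) (x, t₀) := fun x hx i =>
    (hR i).contDiffAt (hnhds x hx)
  set w₁ : ℝ × ℝ → ℝ := fun y => W₁ y / Real.sqrt (met R 0 0 (y, t₀)) with hw₁
  set w₂ : ℝ × ℝ → ℝ := fun y => W₂ y / Real.sqrt (met R 0 0 (y, t₀)) with hw₂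
  have hv : ∀ x ∈ Ω, ∀ i, vel R (x, t₀) i =
      Un x * nor R (x, t₀) i + w₁ x * aV R 0 (x, t₀) i + w₂ x * aV R 1 (x, t₀) i := by
    intro x hx i
    rw [hvel x hx i]; simp only [hw₁, hw₂]; ring
  have main : ∀ x ∈ Ω,
      pdT (fun q => met R 0 0 q - met R 1 1 q) (x, t₀) =
        2 * (met R 0 0 (x, t₀) * (pd1 w₁ x - pd2 w₂ x)
          - Un x * (bform R 0 0 (x, t₀) - bform R 1 1 (x, t₀))) ∧
      pdT (met R 0 1) (x, t₀) =
        met R 0 0 (x, t₀) * (pd2 w₁ x + pd1 w₂ x) - 2 * Un x * bform R 0 1 (x, t₀) := by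
    intro x hx
    obtain ⟨hEG, hF, hE⟩ := hiso x hx
    have hΩx : Ω ∈ nhds x := hΩ.mem_nhds hx
    have da : ∀ α i, DifferentiableAt ℝ (fun q => aV R α q i) (x, t₀) := fun α i =>
      (s18_dd _ _ (sdir α) 0 (hsm x hx i)).1
    have dv : ∀ i, DifferentiableAt ℝ (fun q => vel R q i) (x, t₀) := fun i =>
      (s18_dd _ _ ((0,0),1) 0 (hsm x hx i)).1
    -- spatial derivative of a_β and v
    let c : Fin 2 → Fin 2 → V3 := fun k β i => pdS k (fun q => aV R β q i) (x, t₀)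
    let e : Fin 2 → V3 := fun k i => pdS k (fun q => vel R q i) (x, t₀)
    have hc : c 1 0 = c 0 1 := by
      funext i
      exact (s18_dd _ _ (sdir 0) (sdir 1) (hsm x hx i)).2
    have hb : ∀ k β, bform R k β (x, t₀) = dot3 (c k β) (nor R (x, t₀)) := fun k β => rfl
    have hT : ∀ α β, DifferentiableAt ℝ (met R α β) (x, t₀) ∧ pdT (met R α β) (x, t₀) =
        dot3 (e α) (aV R β (x, t₀)) + dot3 (aV R α (x, t₀)) (e β) := by
      intro α β
      have h := s18_dot (aV R α) (aV R β) (x, t₀) ((0,0),1) _ _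
        (fun i => (da α i).hasFDerivAt) (fun i => (da β i).hasFDerivAt)
      have he : ∀ γ, e γ = fun i => fderiv ℝ (fun q => aV R γ q i) (x, t₀) ((0,0),1) := by
        intro γ; funext i
        exact (s18_dd _ _ ((0,0),1) (sdir γ) (hsm x hx i)).2
      rw [he α, he β]
      exact h
    let d : Fin 2 → ℝ × ℝ := ![(1,0),(0,1)]
    have hd : ∀ k, ((d k, (0:ℝ)) : Pt) = sdir k := by
      intro k; fin_cases k <;> rfl
    let D : Fin 2 → (ℝ × ℝ → ℝ) → ℝ := fun k f => fderiv ℝ f x (d k)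
    have hD : ∀ k α β, D k (fun y => met R α β (y, t₀)) =
        dot3 (c k α) (aV R β (x, t₀)) + dot3 (aV R α (x, t₀)) (c k β) := by
      intro k α β
      have h := (s18_dot (fun y => aV R α (y, t₀)) (fun y => aV R β (y, t₀)) x (d k) _ _
        (fun i => s18_slice _ _ _ (da α i)) (fun i => s18_slice _ _ _ (da β i))).2
      simp only [ContinuousLinearMap.comp_apply, ContinuousLinearMap.inl_apply, hd] at h
      exact h
    have hDv : ∀ k β, D k (fun y => dot3 (vel R (y, t₀)) (aV R β (y, t₀))) =
        dot3 (e k) (aV R β (x, t₀)) + dot3 (vel R (x, t₀)) (c k β) := by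
      intro k β
      have h := (s18_dot (fun y => vel R (y, t₀)) (fun y => aV R β (y, t₀)) x (d k) _ _
        (fun i => s18_slice _ _ _ (dv i)) (fun i => s18_slice _ _ _ (da β i))).2
      simp only [ContinuousLinearMap.comp_apply, ContinuousLinearMap.inl_apply, hd] at h
      exact h
    have dE : DifferentiableAt ℝ (fun y => met R 0 0 (y, t₀)) x :=
      (s18_slice _ _ _ (hT 0 0).1).differentiableAt
    have dW₁ : DifferentiableAt ℝ w₁ x := by
      have hq := dE.sqrt hE.ne'
      have hp : DifferentiableAt ℝ W₁ x := (hW₁.contDiffAt hΩx).differentiableAt (by simp)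
      have hn := (Real.sqrt_pos.2 hE).ne'
      have hm := hp.fun_mul (hq.fun_inv hn)
      simpa only [← div_eq_mul_inv] using hm
    have dW₂ : DifferentiableAt ℝ w₂ x := by
      have hq := dE.sqrt hE.ne'
      have hp : DifferentiableAt ℝ W₂ x := (hW₂.contDiffAt hΩx).differentiableAt (by simp)
      have hn := (Real.sqrt_pos.2 hE).ne'
      have hm := hp.fun_mul (hq.fun_inv hn)
      simpa only [← div_eq_mul_inv] using hm
    have hmul : ∀ k (w : ℝ × ℝ → ℝ), DifferentiableAt ℝ w x →
        D k (fun y => w y * met R 0 0 (y, t₀)) =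
          D k w * met R 0 0 (x, t₀) + w x * D k (fun y => met R 0 0 (y, t₀)) := by
      intro k w hw
      have h : HasFDerivAt (fun y => w y * met R 0 0 (y, t₀)) _ x :=
        hw.hasFDerivAt.mul dE.hasFDerivAt
      simp only [D]
      rw [h.fderiv]
      simp
      ring
    have hcongr : ∀ k (f g : ℝ × ℝ → ℝ), (∀ y ∈ Ω, f y = g y) → D k f = D k g := by
      intro k f g hfg
      have : f =ᶠ[nhds x] g := Filter.eventually_of_mem hΩx hfg
      simp only [D]
      rw [this.fderiv_eq]
    have hv0 : ∀ k, D k w₁ * met R 0 0 (x, t₀) + w₁ x * D k (fun y => met R 0 0 (y, t₀)) =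
        dot3 (e k) (aV R 0 (x, t₀)) + dot3 (vel R (x, t₀)) (c k 0) := by
      intro k
      rw [← hDv, ← hmul k w₁ dW₁]
      apply hcongr
      intro y hy
      rw [s18_lin _ _ _ _ _ _ _ _ (hv y hy), (s18_nor R _).1, s18_comm (aV R 1 _)]
      have h2 := (hiso y hy).2.1
      simp only [met] at h2 ⊢
      rw [h2]; ring
    have hv1 : ∀ k, D k w₂ * met R 0 0 (x, t₀) + w₂ x * D k (fun y => met R 0 0 (y, t₀)) =
        dot3 (e k) (aV R 1 (x, t₀)) + dot3 (vel R (x, t₀)) (c k 1) := by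
      intro k
      rw [← hDv, ← hmul k w₂ dW₂]
      apply hcongr
      intro y hy
      rw [s18_lin _ _ _ _ _ _ _ _ (hv y hy), (s18_nor R _).2, (hiso y hy).1]
      have h2 := (hiso y hy).2.1
      simp only [met] at h2 ⊢
      rw [h2]; ring
    have hEGd : ∀ k, D k (fun y => met R 0 0 (y, t₀)) = D k (fun y => met R 1 1 (y, t₀)) :=
      fun k => hcongr k _ _ fun y hy => (hiso y hy).1
    have hFd : ∀ k, D k (fun y => met R 0 1 (y, t₀)) = 0 := by
      intro k
      rw [hcongr k _ (fun _ => 0) fun y hy => (hiso y hy).2.1]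
      simp [D]
    have hvc : ∀ k β, dot3 (vel R (x, t₀)) (c k β) = Un x * bform R k β (x, t₀) +
        w₁ x * dot3 (aV R 0 (x, t₀)) (c k β) + w₂ x * dot3 (aV R 1 (x, t₀)) (c k β) := by
      intro k β
      rw [s18_lin _ _ _ _ _ _ _ _ (hv x hx), hb, s18_comm (nor R _)]
    have hb10 : bform R 1 0 (x, t₀) = bform R 0 1 (x, t₀) := by rw [hb, hb, hc]
    have p1 : ∀ f, pd1 f x = D 0 f := fun f => rfl
    have p2 : ∀ f, pd2 f x = D 1 f := fun f => rfl
    have hsub : pdT (fun q => met R 0 0 q - met R 1 1 q) (x, t₀) =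
        pdT (met R 0 0) (x, t₀) - pdT (met R 1 1) (x, t₀) := by
      have h : HasFDerivAt (fun q => met R 0 0 q - met R 1 1 q) _ (x, t₀) :=
        (hT 0 0).1.hasFDerivAt.sub (hT 1 1).1.hasFDerivAt
      simp only [pdT]
      rw [h.fderiv]; rfl
    rw [hsub, (hT 0 0).2, (hT 1 1).2, (hT 0 1).2, p1, p1, p2, p2]
    have cm : ∀ α k β, dot3 (c k β) (aV R α (x, t₀)) = dot3 (aV R α (x, t₀)) (c k β) :=
      fun _ _ _ => s18_comm _ _
    have ce : ∀ α k, dot3 (aV R α (x, t₀)) (e k) = dot3 (e k) (aV R α (x, t₀)) :=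
      fun _ _ => s18_comm _ _
    have A00 := hv0 0
    have A01 := hv0 1
    have A10 := hv1 0
    have A11 := hv1 1
    have B0 := hEGd 0
    have B1 := hEGd 1
    have F0 := hFd 0
    have F1 := hFd 1
    simp only [hvc, hD, cm, ce, hb10, hc] at A00 A01 A10 A11 B0 B1 F0 F1 ⊢
    constructor
    · linear_combination (-2) * A00 + 2 * A11 + w₁ x * (B0 + 2 * F1) - w₂ x * (2 * F0 + B1)
    · linear_combination (-1) * A10 - A01 + w₂ x * B0
  constructor
  · intro h x hx
    obtain ⟨m1, m2⟩ := main x hx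
    obtain ⟨h1, h2⟩ := h x hx
    have hE := (hiso x hx).2.2
    rw [h1] at m1; rw [h2] at m2
    constructor
    · rw [eq_div_iff hE.ne']; linarith
    · rw [eq_div_iff hE.ne']; linarith
  · intro h x hx
    obtain ⟨m1, m2⟩ := main x hx
    obtain ⟨h1, h2⟩ := h x hx
    have hE := (hiso x hx).2.2
    rw [eq_div_iff hE.ne'] at h1 h2
    rw [m1, m2]
    constructor <;> linarith
end
end
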